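/- Let G be a countable discrete amenable group, (V,‖·‖) a complete semi-normed real vector space, π: G → Isom(V) a uniformly bounded representation, φ ∈ M, and W ⊆ V a non-empty subset. The following are equivalent: (A1) φ is asymptotically additive relative to W, i.e. inf_{w∈W} limsup_{F→G} ‖φ(F)/|F| − A_F w‖ = 0; (A2) there exists an additive realization v of φ with v in the ‖·‖-closure of W + L_W. In particular, if φ is asymptotically additive relative to W, then R_φ ⊆ cl(W + L), and exactly one of the following dichotomy branches holds: (B1) there exists an additive realization w ∈ W of φ, or (B2) there exists an additive realization v ∈ V \ (W + cl(L)) of φ. -/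

import Mathlib

open scoped Pointwise
open Filter

/-- The collection `F(G)` of non-empty finite subsets of `G`. -/
def FinG (G : Type*) := {F : Finset G // F.Nonempty}

section Defs

variable {G : Type*} [Group G] [DecidableEq G]

/-- `F` is `(K, δ)`-invariant: `|KF Δ F| ≤ δ|F|`. -/
def IsInv (K : Finset G) (δ : ℝ) (F : Finset G) : Prop :=
  ((symmDiff (K * F) F).card : ℝ) ≤ δ * (F.card : ℝ)

/-- `G` is amenable: for every `(K, δ)` there is a `(K, δ)`-invariant nonempty finite set. -/
def AmenableG (G : Type*) [Group G] [DecidableEq G] : Prop :=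
  ∀ K : Finset G, K.Nonempty → ∀ δ : ℝ, 0 < δ →
    ∃ F : Finset G, F.Nonempty ∧ IsInv K δ F

/-- `limsup_{F → G} φ(F) = inf_{(K,δ)} sup {φ(F) : F is (K,δ)-invariant}` (in the extended reals). -/
noncomputable def limsupG (φ : FinG G → ℝ) : EReal :=
  ⨅ (K : {K : Finset G // K.Nonempty}) (δ : {d : ℝ // 0 < d}),
    ⨆ F : {F : FinG G // IsInv K.1 δ.1 F.1}, (φ F.1 : EReal)

/-- `liminf_{F → G} φ(F) = sup_{(K,δ)} inf {φ(F) : F is (K,δ)-invariant}` (in the extended reals). -/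
noncomputable def liminfG (φ : FinG G → ℝ) : EReal :=
  ⨆ (K : {K : Finset G // K.Nonempty}) (δ : {d : ℝ // 0 < d}),
    ⨅ F : {F : FinG G // IsInv K.1 δ.1 F.1}, (φ F.1 : EReal)

/-- `lim_{F → G} φ(F) = L`. -/
def TendstoG (φ : FinG G → ℝ) (L : ℝ) : Prop :=
  ∀ ε : ℝ, 0 < ε → ∃ (K : Finset G) (δ : ℝ), K.Nonempty ∧ 0 < δ ∧
    ∀ F : FinG G, IsInv K δ F.1 → |φ F - L| < ε

/-- A (left) Følner sequence: `|F_n Δ g F_n| / |F_n| → 0` for every `g ∈ G`. -/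
def FolnerSeq (F : ℕ → FinG G) : Prop :=
  ∀ g : G, Filter.Tendsto
    (fun n => ((symmDiff ((F n).1.image (fun h => g * h)) (F n).1).card : ℝ) / ((F n).1.card : ℝ))
    Filter.atTop (nhds (0 : ℝ))

variable {V : Type*} [SeminormedAddCommGroup V] [NormedSpace ℝ V]

/-- The representation `π` is uniformly bounded with constant `C`. -/
def UnifBdd (π : G →* (V ≃L[ℝ] V)) (C : ℝ) : Prop :=
  ∀ (g : G) (v : V), ‖π g v‖ ≤ C * ‖v‖

/-- The representation `π` is isometric (`C_π = 1`). -/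
def IsIsometric (π : G →* (V ≃L[ℝ] V)) : Prop :=
  ∀ (g : G) (v : V), ‖π g v‖ = ‖v‖

/-- The ergodic sum `S_F v = Σ_{g ∈ F} π(g⁻¹) v`. -/
noncomputable def SF (π : G →* (V ≃L[ℝ] V)) (F : Finset G) (v : V) : V :=
  ∑ g ∈ F, π g⁻¹ v

/-- The ergodic average `A_F v = |F|⁻¹ • S_F v`. -/
noncomputable def AF (π : G →* (V ≃L[ℝ] V)) (F : Finset G) (v : V) : V :=
  (F.card : ℝ)⁻¹ • SF π F v

/-- Right translation `g • F = F g⁻¹` on nonempty finite subsets. -/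
def rT (g : G) (F : FinG G) : FinG G :=
  ⟨F.1.image (fun h => h * g⁻¹), F.2.image (fun h => h * g⁻¹)⟩

/-- `G`-equivariance of a set map: `π(g) φ(F) = φ(F g⁻¹)`. -/
def IsEquivariant (π : G →* (V ≃L[ℝ] V)) (φ : FinG G → V) : Prop :=
  ∀ (g : G) (F : FinG G), π g (φ F) = φ (rT g F)

/-- Boundedness of a set map: `sup_F ‖φ(F)‖/|F| < ∞`. -/
def IsBddMap (φ : FinG G → V) : Prop :=
  ∃ C : ℝ, ∀ F : FinG G, ‖φ F‖ ≤ C * (F.1.card : ℝ)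

/-- Membership in the space `M` of bounded `G`-equivariant set maps. -/
def MemM (π : G →* (V ≃L[ℝ] V)) (φ : FinG G → V) : Prop :=
  IsBddMap φ ∧ IsEquivariant π φ

/-- The sup seminorm `|||φ|||_sup = sup_F ‖φ(F)‖/|F|`. -/
noncomputable def supNorm (φ : FinG G → V) : ℝ :=
  ⨆ F : FinG G, ‖φ F‖ / (F.1.card : ℝ)

/-- The asymptotic seminorm `|||φ|||_G = limsup_{F → G} ‖φ(F)‖/|F|` (in the extended reals). -/
noncomputable def normG (φ : FinG G → V) : EReal :=
  limsupG (fun F => ‖φ F‖ / (F.1.card : ℝ))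

/-- Union of nonempty finite subsets. -/
def unionF (E F : FinG G) : FinG G :=
  ⟨E.1 ∪ F.1, E.2.inl⟩

/-- Additive set maps: `φ(E ⊔ F) = φ(E) + φ(F)` for disjoint `E, F`. -/
def IsAdditiveMap (φ : FinG G → V) : Prop :=
  ∀ E F : FinG G, Disjoint E.1 F.1 → φ (unionF E F) = φ E + φ F

/-- The additive set map `S(v)(F) = S_F v`. -/
noncomputable def Smap (π : G →* (V ≃L[ℝ] V)) (v : V) : FinG G → V :=
  fun F => SF π F.1 v

/-- The coboundary subspace `L_W = span{w − π(g)w : w ∈ W, g ∈ G}`. -/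
def cobSpan (π : G →* (V ≃L[ℝ] V)) (W : Set V) : Submodule ℝ V :=
  Submodule.span ℝ {x | ∃ w ∈ W, ∃ g : G, x = w - π g w}

/-- The coboundary subspace `L = L_V`. -/
def cobL (π : G →* (V ≃L[ℝ] V)) : Submodule ℝ V :=
  cobSpan π Set.univ

/-- The quotient seminorm `‖v + U‖_U = inf_{u ∈ U} ‖v + u‖`. -/
noncomputable def qnorm (U : Set V) (v : V) : ℝ :=
  ⨅ u : U, ‖v + u.1‖

/-- `v` is an additive realization of `φ`: `lim_{F→G} ‖φ(F)/|F| − A_F v‖ = 0`. -/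
def IsRealization (π : G →* (V ≃L[ℝ] V)) (φ : FinG G → V) (v : V) : Prop :=
  TendstoG (fun F => ‖(F.1.card : ℝ)⁻¹ • φ F - AF π F.1 v‖) 0

/-- `φ` is asymptotically additive: `inf_{ψ ∈ M_⊕} |||φ − ψ|||_G = 0`. -/
def AsympAdd (π : G →* (V ≃L[ℝ] V)) (φ : FinG G → V) : Prop :=
  (⨅ ψ : {ψ : FinG G → V // MemM π ψ ∧ IsAdditiveMap ψ}, normG (φ - ψ.1)) = (0 : EReal)

/-- `φ` is asymptotically additive relative to `W`. -/
def AsympAddRel (π : G →* (V ≃L[ℝ] V)) (W : Set V) (φ : FinG G → V) : Prop :=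
  (⨅ w : W, limsupG (fun F => ‖(F.1.card : ℝ)⁻¹ • φ F - AF π F.1 w.1‖)) = (0 : EReal)

/-- The quotient norm on `M_⊕ / N_⊕`. -/
noncomputable def qMplusN (π : G →* (V ≃L[ℝ] V)) (ψ : FinG G → V) : ℝ :=
  ⨅ η : {η : FinG G → V // MemM π η ∧ IsAdditiveMap η ∧ normG η = (0 : EReal)},
    supNorm (ψ + η.1)

end Defs

section FolnerFilter

variable {G : Type*} [Group G] [DecidableEq G]

theorem card_sdiff_smul_le {K : Finset G} {k : G} (hk : k ∈ K) (F : Finset G) :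
    (F \ ({k} * F)).card ≤ ((K * F) \ F).card := by
  have h : ({k} * F : Finset G).card = F.card := Finset.card_singleton_mul k F
  rw [← Finset.card_sdiff_comm h]
  exact Finset.card_le_card (Finset.sdiff_subset_sdiff
    (Finset.mul_subset_mul_right (Finset.singleton_subset_iff.2 hk)) subset_rfl)

theorem IsInv.of_subset {K K' : Finset G} (hK : K.Nonempty) (h : K ⊆ K') {δ : ℝ} {F : Finset G}
    (hF : IsInv K' (δ / 2) F) : IsInv K δ F := by
  obtain ⟨k, hk⟩ := hK
  have h1 : ((K * F) \ F).card ≤ ((K' * F) \ F).card :=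
    Finset.card_le_card (Finset.sdiff_subset_sdiff (Finset.mul_subset_mul_right h) subset_rfl)
  have h2 : (F \ (K * F)).card ≤ ((K' * F) \ F).card :=
    (Finset.card_le_card (Finset.sdiff_subset_sdiff subset_rfl
      (Finset.mul_subset_mul_right (Finset.singleton_subset_iff.2 hk)))).trans
      (card_sdiff_smul_le (h hk) F)
  have h3 : (symmDiff (K * F) F).card ≤ ((K * F) \ F).card + (F \ (K * F)).card :=
    Finset.card_union_le _ _
  have h4 : ((K' * F) \ F).card ≤ (symmDiff (K' * F) F).card :=
    Finset.card_le_card Finset.subset_union_left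
  have h5 : ((symmDiff (K * F) F).card : ℝ) ≤ 2 * (symmDiff (K' * F) F).card := by
    exact_mod_cast (by omega : (symmDiff (K * F) F).card ≤ 2 * (symmDiff (K' * F) F).card)
  unfold IsInv at *
  linarith

theorem IsInv.mono {K : Finset G} {δ δ' : ℝ} (h : δ ≤ δ') {F : Finset G}
    (hF : IsInv K δ F) : IsInv K δ' F :=
  le_trans hF (mul_le_mul_of_nonneg_right h (Nat.cast_nonneg _))

/-- The filter of increasingly invariant sets, describing `F → G`. -/
def folnerFilter (G : Type*) [Group G] [DecidableEq G] : Filter (FinG G) where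
  sets := {S | ∃ (K : Finset G) (δ : ℝ), K.Nonempty ∧ 0 < δ ∧ ∀ F : FinG G, IsInv K δ F.1 → F ∈ S}
  univ_sets := ⟨{1}, 1, Finset.singleton_nonempty 1, one_pos, fun _ _ => trivial⟩
  sets_of_superset := by
    rintro S T ⟨K, δ, hK, hδ, h⟩ hST
    exact ⟨K, δ, hK, hδ, fun F hF => hST (h F hF)⟩
  inter_sets := by
    rintro S T ⟨K, δ, hK, hδ, h⟩ ⟨K', δ', hK', hδ', h'⟩
    refine ⟨K ∪ K', min δ δ' / 2, hK.inl, half_pos (lt_min hδ hδ'), fun F hF => ⟨h F ?_, h' F ?_⟩⟩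
    · exact (hF.of_subset hK Finset.subset_union_left).mono (min_le_left _ _)
    · exact (hF.of_subset hK' Finset.subset_union_right).mono (min_le_right _ _)

theorem eventually_folnerFilter {p : FinG G → Prop} :
    (∀ᶠ F in folnerFilter G, p F) ↔
      ∃ (K : Finset G) (δ : ℝ), K.Nonempty ∧ 0 < δ ∧ ∀ F : FinG G, IsInv K δ F.1 → p F :=
  Iff.rfl

theorem AmenableG.neBot (hG : AmenableG G) : (folnerFilter G).NeBot := by
  refine ⟨fun h => ?_⟩
  have : ∀ᶠ _ in folnerFilter G, False := by rw [h]; exact Filter.eventually_bot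
  obtain ⟨K, δ, hK, hδ, hF⟩ := eventually_folnerFilter.1 this
  obtain ⟨F, hne, hinv⟩ := hG K hK δ hδ
  exact hF ⟨F, hne⟩ hinv

theorem tendstoG_iff {f : FinG G → ℝ} {a : ℝ} :
    TendstoG f a ↔ Tendsto f (folnerFilter G) (nhds a) := by
  rw [Metric.tendsto_nhds]
  rfl

theorem eventually_lt_of_limsupG_lt {f : FinG G → ℝ} {a : ℝ} (h : limsupG f < (a : EReal)) :
    ∀ᶠ F in folnerFilter G, f F < a := by
  obtain ⟨K, hK⟩ := iInf_lt_iff.1 h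
  obtain ⟨δ, hδ⟩ := iInf_lt_iff.1 hK
  refine eventually_folnerFilter.2 ⟨K.1, δ.1, K.2, δ.2, fun F hF => ?_⟩
  exact_mod_cast (le_iSup (fun F : {F : FinG G // IsInv K.1 δ.1 F.1} => (f F.1 : EReal))
    ⟨F, hF⟩).trans_lt hδ

theorem limsupG_le_of_eventually_le {f : FinG G → ℝ} {a : ℝ}
    (h : ∀ᶠ F in folnerFilter G, f F ≤ a) : limsupG f ≤ (a : EReal) := by
  obtain ⟨K, δ, hK, hδ, hF⟩ := eventually_folnerFilter.1 h
  exact iInf_le_of_le ⟨K, hK⟩ (iInf_le_of_le ⟨δ, hδ⟩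
    (iSup_le fun F => EReal.coe_le_coe_iff.2 (hF F.1 F.2)))

theorem limsupG_nonneg (hG : AmenableG G) {f : FinG G → ℝ} (hf : ∀ F, 0 ≤ f F) :
    0 ≤ limsupG f := by
  refine le_iInf fun K => le_iInf fun δ => ?_
  obtain ⟨F, hne, hinv⟩ := hG K.1 K.2 δ.1 δ.2
  exact (EReal.coe_nonneg.2 (hf ⟨F, hne⟩)).trans
    (le_iSup (fun F : {F : FinG G // IsInv K.1 δ.1 F.1} => (f F.1 : EReal)) ⟨⟨F, hne⟩, hinv⟩)

end FolnerFilter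

section ErgodicAverages

variable {G : Type*} [Group G]
  {V : Type*} [SeminormedAddCommGroup V] [NormedSpace ℝ V]

theorem AF_add (π : G →* (V ≃L[ℝ] V)) (F : Finset G) (v w : V) :
    AF π F (v + w) = AF π F v + AF π F w := by
  simp [AF, SF, Finset.sum_add_distrib]

theorem AF_sub (π : G →* (V ≃L[ℝ] V)) (F : Finset G) (v w : V) :
    AF π F (v - w) = AF π F v - AF π F w := by
  simp [AF, SF, Finset.sum_sub_distrib, smul_sub]

theorem AF_smul (π : G →* (V ≃L[ℝ] V)) (F : Finset G) (c : ℝ) (v : V) :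
    AF π F (c • v) = c • AF π F v := by
  simp [AF, SF, ← Finset.smul_sum, smul_comm c]

theorem norm_SF_le {π : G →* (V ≃L[ℝ] V)} {C : ℝ} (hπ : UnifBdd π C) (F : Finset G) (v : V) :
    ‖SF π F v‖ ≤ F.card * (C * ‖v‖) :=
  (norm_sum_le_of_le F fun g _ => hπ g⁻¹ v).trans_eq (by simp)

theorem norm_AF_le {π : G →* (V ≃L[ℝ] V)} {C : ℝ} (hπ : UnifBdd π C) (F : FinG G) (v : V) :
    ‖AF π F.1 v‖ ≤ C * ‖v‖ := by
  have hF : (0 : ℝ) < F.1.card := by exact_mod_cast F.2.card_pos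
  rw [AF, norm_smul, Real.norm_of_nonneg (inv_nonneg.2 hF.le), inv_mul_le_iff₀ hF]
  exact norm_SF_le hπ F.1 v

theorem sub_AF_mem_cobSpan (π : G →* (V ≃L[ℝ] V)) {W : Set V} {w : V} (hw : w ∈ W) (F : FinG G) :
    w - AF π F.1 w ∈ cobSpan π W := by
  have hF : (F.1.card : ℝ) ≠ 0 := by exact_mod_cast F.2.card_pos.ne'
  have h : w - AF π F.1 w = (F.1.card : ℝ)⁻¹ • ∑ g ∈ F.1, (w - π g⁻¹ w) := by
    rw [Finset.sum_sub_distrib, smul_sub, Finset.sum_const, ← Nat.cast_smul_eq_nsmul ℝ,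
      inv_smul_smul₀ hF]
    rfl
  rw [h]
  exact Submodule.smul_mem _ _
    (Submodule.sum_mem _ fun g _ => Submodule.subset_span ⟨w, hw, g⁻¹, rfl⟩)

variable [DecidableEq G]

theorem norm_SF_sub_map_le {π : G →* (V ≃L[ℝ] V)} {C : ℝ} (hπ : UnifBdd π C) (g : G)
    (F : Finset G) (w : V) :
    ‖SF π F (w - π g w)‖ ≤ (symmDiff ({g⁻¹} * F) F).card * (C * ‖w‖) := by
  have h1 : SF π F (π g w) = SF π ({g⁻¹} * F) w := by
    rw [Finset.singleton_mul, ← Finset.image_smul, SF, SF,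
      Finset.sum_image (MulAction.injective g⁻¹).injOn]
    refine Finset.sum_congr rfl fun x _ => ?_
    rw [smul_eq_mul, mul_inv_rev, inv_inv, map_mul]
    rfl
  have h2 : SF π F (w - π g w) = SF π (F \ ({g⁻¹} * F)) w - SF π (({g⁻¹} * F) \ F) w := by
    have : SF π F (w - π g w) = SF π F w - SF π F (π g w) := by
      simp [SF, Finset.sum_sub_distrib]
    rw [this, h1]
    exact Finset.sum_sdiff_sub_sum_sdiff.symm
  have h3 : (symmDiff ({g⁻¹} * F) F).card
      = (({g⁻¹} * F) \ F).card + (F \ ({g⁻¹} * F)).card :=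
    Finset.card_union_of_disjoint disjoint_sdiff_sdiff
  rw [h2, h3]
  push_cast
  linarith [norm_sub_le (SF π (F \ ({g⁻¹} * F)) w) (SF π (({g⁻¹} * F) \ F) w),
    norm_SF_le hπ (F \ ({g⁻¹} * F)) w, norm_SF_le hπ (({g⁻¹} * F) \ F) w]

theorem tendsto_AF_sub_map {π : G →* (V ≃L[ℝ] V)} {C : ℝ} (hC : 0 ≤ C) (hπ : UnifBdd π C) (g : G)
    (w : V) : Tendsto (fun F : FinG G => AF π F.1 (w - π g w)) (folnerFilter G) (nhds 0) := by
  rw [NormedAddGroup.tendsto_nhds_zero]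
  intro ε hε
  have hB : 0 < C * ‖w‖ + 1 := by positivity
  refine eventually_folnerFilter.2
    ⟨{g⁻¹}, ε / (C * ‖w‖ + 1), Finset.singleton_nonempty _, by positivity, fun F hinv => ?_⟩
  have hF : (0 : ℝ) < F.1.card := by exact_mod_cast F.2.card_pos
  rw [AF, norm_smul, Real.norm_of_nonneg (inv_nonneg.2 hF.le), inv_mul_lt_iff₀ hF]
  calc ‖SF π F.1 (w - π g w)‖ ≤ (symmDiff ({g⁻¹} * F.1) F.1).card * (C * ‖w‖) :=
        norm_SF_sub_map_le hπ g F.1 w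
    _ ≤ ε / (C * ‖w‖ + 1) * F.1.card * (C * ‖w‖) :=
        mul_le_mul_of_nonneg_right hinv (by positivity)
    _ < ε / (C * ‖w‖ + 1) * F.1.card * (C * ‖w‖ + 1) :=
        mul_lt_mul_of_pos_left (lt_add_one _) (by positivity)
    _ = F.1.card * ε := by field_simp

theorem tendsto_AF_of_mem_cobSpan {π : G →* (V ≃L[ℝ] V)} {C : ℝ} (hC : 0 ≤ C) (hπ : UnifBdd π C)
    {W : Set V} {l : V} (hl : l ∈ cobSpan π W) :
    Tendsto (fun F : FinG G => AF π F.1 l) (folnerFilter G) (nhds 0) := by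
  induction hl using Submodule.span_induction with
  | mem x hx =>
    obtain ⟨w, -, g, rfl⟩ := hx
    exact tendsto_AF_sub_map hC hπ g w
  | zero => simpa [AF, SF] using tendsto_const_nhds
  | add x y _ _ hx hy => simpa [AF_add] using hx.add hy
  | smul c x _ hx => simpa [AF_smul] using hx.const_smul c

theorem tendsto_of_approx_mod_cobSpan {π : G →* (V ≃L[ℝ] V)} {C : ℝ} (hC : 0 ≤ C)
    (hπ : UnifBdd π C) {W : Set V} {a : FinG G → V} {v : V}
    (h : ∀ ε > 0, ∃ w, ∃ l ∈ cobSpan π W, ‖v - (w + l)‖ < ε ∧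
      ∀ᶠ F in folnerFilter G, ‖a F - AF π F.1 w‖ < ε) :
    Tendsto (fun F => a F - AF π F.1 v) (folnerFilter G) (nhds 0) := by
  rw [NormedAddGroup.tendsto_nhds_zero]
  intro ε hε
  have hC2 : 0 < C + 2 := by positivity
  obtain ⟨w, l, hl, hv, hw⟩ := h (ε / (C + 2)) (by positivity)
  have hl' := (NormedAddGroup.tendsto_nhds_zero.1 (tendsto_AF_of_mem_cobSpan hC hπ hl))
    (ε / (C + 2)) (by positivity)
  filter_upwards [hw, hl'] with F h1 h2
  have h3 : a F - AF π F.1 v = (a F - AF π F.1 w) - AF π F.1 l - AF π F.1 (v - (w + l)) := by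
    rw [AF_sub, AF_add]
    abel
  have h4 := (norm_AF_le hπ F (v - (w + l))).trans (mul_le_mul_of_nonneg_left hv.le hC)
  have h5 : ε / (C + 2) + ε / (C + 2) + C * (ε / (C + 2)) = ε := by
    field_simp
    ring
  rw [h3]
  linarith [norm_sub_le ((a F - AF π F.1 w) - AF π F.1 l) (AF π F.1 (v - (w + l))),
    norm_sub_le (a F - AF π F.1 w) (AF π F.1 l)]

theorem exists_mem_cobSpan_norm_lt (hG : AmenableG G) {π : G →* (V ≃L[ℝ] V)} {W : Set V}
    {a : FinG G → V} {x y : V} (hx : x ∈ W) (hy : y ∈ W) {ε δ : ℝ}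
    (hxa : ∀ᶠ F in folnerFilter G, ‖a F - AF π F.1 x‖ < ε)
    (hya : ∀ᶠ F in folnerFilter G, ‖a F - AF π F.1 y‖ < δ) :
    ∃ l ∈ cobSpan π W, ‖x - (y + l)‖ < ε + δ := by
  have := hG.neBot
  obtain ⟨F, h1, h2⟩ := (hxa.and hya).exists
  refine ⟨(x - AF π F.1 x) - (y - AF π F.1 y),
    Submodule.sub_mem _ (sub_AF_mem_cobSpan π hx F) (sub_AF_mem_cobSpan π hy F), ?_⟩
  have h3 : x - (y + ((x - AF π F.1 x) - (y - AF π F.1 y)))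
      = (a F - AF π F.1 y) - (a F - AF π F.1 x) := by abel
  rw [h3]
  linarith [norm_sub_le (a F - AF π F.1 y) (a F - AF π F.1 x)]

theorem isRealization_iff {π : G →* (V ≃L[ℝ] V)} {φ : FinG G → V} {v : V} :
    IsRealization π φ v ↔
      Tendsto (fun F => (F.1.card : ℝ)⁻¹ • φ F - AF π F.1 v) (folnerFilter G) (nhds 0) := by
  rw [IsRealization, tendstoG_iff, ← tendsto_zero_iff_norm_tendsto_zero]

theorem IsRealization.eventually_lt {π : G →* (V ≃L[ℝ] V)} {φ : FinG G → V} {v : V}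
    (h : IsRealization π φ v) {ε : ℝ} (hε : 0 < ε) :
    ∀ᶠ F in folnerFilter G, ‖(F.1.card : ℝ)⁻¹ • φ F - AF π F.1 v‖ < ε :=
  NormedAddGroup.tendsto_nhds_zero.1 (isRealization_iff.1 h) ε hε

theorem asympAddRel_iff (hG : AmenableG G) {π : G →* (V ≃L[ℝ] V)} {φ : FinG G → V} {W : Set V} :
    AsympAddRel π W φ ↔ ∀ ε > 0, ∃ w ∈ W,
      ∀ᶠ F in folnerFilter G, ‖(F.1.card : ℝ)⁻¹ • φ F - AF π F.1 w‖ < ε := by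
  constructor
  · intro h ε hε
    have hlt : (⨅ w : W, limsupG (fun F => ‖(F.1.card : ℝ)⁻¹ • φ F - AF π F.1 w.1‖))
        < (ε : EReal) := h.trans_lt (EReal.coe_pos.2 hε)
    obtain ⟨w, hw⟩ := iInf_lt_iff.1 hlt
    exact ⟨w.1, w.2, eventually_lt_of_limsupG_lt hw⟩
  · intro h
    refine le_antisymm (EReal.le_of_forall_lt_iff_le.1 fun ε hε => ?_)
      (le_iInf fun w => limsupG_nonneg hG fun F => norm_nonneg _)
    obtain ⟨w, hw, hF⟩ := h ε (EReal.coe_pos.1 hε)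
    exact iInf_le_of_le ⟨w, hw⟩ (limsupG_le_of_eventually_le (hF.mono fun _ => le_of_lt))

theorem mem_closure_add_iff {W : Set V} {L : Submodule ℝ V} {v : V} :
    v ∈ closure (W + (L : Set V)) ↔ ∀ ε > 0, ∃ w ∈ W, ∃ l ∈ L, ‖v - (w + l)‖ < ε := by
  simp only [SeminormedAddCommGroup.mem_closure_iff, Set.mem_add, SetLike.mem_coe]
  refine forall₂_congr fun ε _ => ⟨?_, ?_⟩
  · rintro ⟨_, ⟨w, hw, l, hl, rfl⟩, h⟩
    exact ⟨w, hw, l, hl, h⟩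
  · rintro ⟨w, hw, l, hl, h⟩
    exact ⟨_, ⟨w, hw, l, hl, rfl⟩, h⟩

theorem IsRealization.sub_mem_closure (hG : AmenableG G) {π : G →* (V ≃L[ℝ] V)} {φ : FinG G → V}
    {v w : V} (hv : IsRealization π φ v) (hw : IsRealization π φ w) :
    v - w ∈ closure (cobL π : Set V) := by
  rw [SeminormedAddCommGroup.mem_closure_iff]
  intro ε hε
  obtain ⟨l, hl, h⟩ := exists_mem_cobSpan_norm_lt hG (Set.mem_univ v) (Set.mem_univ w)
    (hv.eventually_lt (half_pos hε)) (hw.eventually_lt (half_pos hε))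
  refine ⟨l, hl, ?_⟩
  rwa [sub_sub, ← add_halves ε]

theorem IsRealization.sub_closure {π : G →* (V ≃L[ℝ] V)} {C : ℝ} (hC : 0 ≤ C) (hπ : UnifBdd π C)
    {φ : FinG G → V} {w l : V} (h : IsRealization π φ (w + l))
    (hl : l ∈ closure (cobL π : Set V)) : IsRealization π φ w := by
  refine isRealization_iff.2 (tendsto_of_approx_mod_cobSpan (W := Set.univ) hC hπ fun ε hε => ?_)
  obtain ⟨m, hm, hlm⟩ := SeminormedAddCommGroup.mem_closure_iff.1 hl ε hε
  refine ⟨w + l, -m, Submodule.neg_mem _ hm, ?_, h.eventually_lt hε⟩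
  have heq : w - (w + l + -m) = -(l - m) := by abel
  rwa [heq, norm_neg]

theorem AsympAddRel.exists_isRealization [CompleteSpace V] (hG : AmenableG G)
    {π : G →* (V ≃L[ℝ] V)} {C : ℝ} (hC : 0 ≤ C) (hπ : UnifBdd π C) {φ : FinG G → V} {W : Set V}
    (h : AsympAddRel π W φ) :
    ∃ v : V, IsRealization π φ v ∧ v ∈ closure (W + (cobSpan π W : Set V)) := by
  choose w hwW hw using fun n : ℕ =>
    (asympAddRel_iff hG).1 h ((1 / 2 : ℝ) ^ n) (by positivity)
  choose l hlL hl using fun n : ℕ =>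
    exists_mem_cobSpan_norm_lt hG (hwW n) (hwW (n + 1)) (hw n) (hw (n + 1))
  let s : ℕ → V := fun n => ∑ k ∈ Finset.range n, l k
  have hs : ∀ n, s n ∈ cobSpan π W := fun n => Submodule.sum_mem _ fun k _ => hlL k
  have hcauchy : CauchySeq fun n => w n + s n := by
    refine cauchySeq_of_le_geometric (1 / 2) 2 (by norm_num) fun n => ?_
    have heq : w n + s n - (w (n + 1) + s (n + 1)) = w n - (w (n + 1) + l n) := by
      simp only [s, Finset.sum_range_succ]
      abel
    rw [dist_eq_norm, heq]
    have hpow : (1 / 2 : ℝ) ^ (n + 1) ≤ (1 / 2) ^ n :=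
      pow_le_pow_of_le_one (by norm_num) (by norm_num) n.le_succ
    linarith [hl n]
  obtain ⟨v, hv⟩ := cauchySeq_tendsto_of_complete hcauchy
  have hpow : Tendsto (fun n : ℕ => (1 / 2 : ℝ) ^ n) atTop (nhds 0) :=
    tendsto_pow_atTop_nhds_zero_of_lt_one (by norm_num) (by norm_num)
  have happrox : ∀ ε > 0, ∃ n, ‖v - (w n + s n)‖ < ε ∧ (1 / 2 : ℝ) ^ n < ε := fun ε hε => by
    obtain ⟨n, h1, h2⟩ := ((Metric.tendsto_nhds.1 hv ε hε).and
      (hpow.eventually (gt_mem_nhds hε))).exists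
    exact ⟨n, by rwa [← dist_eq_norm, dist_comm], h2⟩
  refine ⟨v, isRealization_iff.2 (tendsto_of_approx_mod_cobSpan (W := W) hC hπ fun ε hε => ?_),
    mem_closure_add_iff.2 fun ε hε => ?_⟩
  · obtain ⟨n, h1, h2⟩ := happrox ε hε
    exact ⟨w n, s n, hs n, h1, (hw n).mono fun _ h => h.trans h2⟩
  · obtain ⟨n, h1, -⟩ := happrox ε hε
    exact ⟨w n, hwW n, s n, hs n, h1⟩

theorem IsRealization.asympAddRel (hG : AmenableG G) {π : G →* (V ≃L[ℝ] V)} {C : ℝ} (hC : 0 ≤ C)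
    (hπ : UnifBdd π C) {φ : FinG G → V} {W : Set V} {v : V} (hv : IsRealization π φ v)
    (hvW : v ∈ closure (W + (cobSpan π W : Set V))) : AsympAddRel π W φ := by
  rw [asympAddRel_iff hG]
  intro ε hε
  have hC2 : 0 < C + 2 := by positivity
  obtain ⟨w, hw, l, hl, hvl⟩ := mem_closure_add_iff.1 hvW (ε / (C + 2)) (by positivity)
  have hl' := (NormedAddGroup.tendsto_nhds_zero.1 (tendsto_AF_of_mem_cobSpan hC hπ hl))
    (ε / (C + 2)) (by positivity)
  refine ⟨w, hw, ?_⟩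
  filter_upwards [hv.eventually_lt (show 0 < ε / (C + 2) by positivity), hl'] with F h1 h2
  have h3 : (F.1.card : ℝ)⁻¹ • φ F - AF π F.1 w
      = ((F.1.card : ℝ)⁻¹ • φ F - AF π F.1 v) + AF π F.1 l + AF π F.1 (v - (w + l)) := by
    rw [AF_sub, AF_add]
    abel
  have h4 := (norm_AF_le hπ F (v - (w + l))).trans (mul_le_mul_of_nonneg_left hvl.le hC)
  have h5 : ε / (C + 2) + ε / (C + 2) + C * (ε / (C + 2)) = ε := by
    field_simp
    ring
  rw [h3]
  linarith [norm_add₃_le (a := (F.1.card : ℝ)⁻¹ • φ F - AF π F.1 v) (b := AF π F.1 l)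
    (c := AF π F.1 (v - (w + l)))]

theorem IsRealization.mem_closure (hG : AmenableG G) {π : G →* (V ≃L[ℝ] V)} {φ : FinG G → V}
    {W : Set V} (h : AsympAddRel π W φ) {v : V} (hv : IsRealization π φ v) :
    v ∈ closure (W + (cobL π : Set V)) := by
  refine mem_closure_add_iff.2 fun ε hε => ?_
  obtain ⟨w, hw, hwF⟩ := (asympAddRel_iff hG).1 h (ε / 2) (half_pos hε)
  obtain ⟨l, hl, hlt⟩ := exists_mem_cobSpan_norm_lt hG (Set.mem_univ v) (Set.mem_univ w)
    (hv.eventually_lt (half_pos hε)) hwF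
  exact ⟨w, hw, l, hl, by rwa [add_halves] at hlt⟩

end ErgodicAverages

theorem statement17 {G : Type*} [Group G] [DecidableEq G] [Countable G]
    {V : Type*} [SeminormedAddCommGroup V] [NormedSpace ℝ V] [CompleteSpace V]
    (hG : AmenableG G) (π : G →* (V ≃L[ℝ] V)) (C : ℝ) (hπ : UnifBdd π C)
    (φ : FinG G → V) (hφ : MemM π φ) (W : Set V) (hW : W.Nonempty) :
    -- (A1) ↔ (A2):
    (AsympAddRel π W φ ↔
      ∃ v : V, IsRealization π φ v ∧ v ∈ closure (W + (cobSpan π W : Set V))) ∧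
    -- in particular, if `φ` is asymptotically additive relative to `W` then
    -- `R_φ ⊆ cl(W + L)` and exactly one of (B1), (B2) holds:
    (AsympAddRel π W φ →
      {v : V | IsRealization π φ v} ⊆ closure (W + (cobL π : Set V)) ∧
      Xor' (∃ w ∈ W, IsRealization π φ w)
        (∃ v : V, IsRealization π φ v ∧ v ∉ W + closure (cobL π : Set V))) := by
  have hC : 0 ≤ |C| := abs_nonneg C
  have hπ' : UnifBdd π |C| := fun g v =>
    (hπ g v).trans (mul_le_mul_of_nonneg_right (le_abs_self C) (norm_nonneg v))
  refine ⟨⟨fun h => h.exists_isRealization hG hC hπ',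
    fun ⟨v, hv, hvW⟩ => hv.asympAddRel hG hC hπ' hvW⟩,
    fun h => ⟨fun v hv => IsRealization.mem_closure hG h hv, ?_⟩⟩
  refine (xor_iff_or_and_not_and _ _).2 ⟨or_iff_not_imp_left.2 fun hB => ?_, ?_⟩
  · obtain ⟨v, hv, -⟩ := h.exists_isRealization hG hC hπ'
    refine ⟨v, hv, ?_⟩
    rintro ⟨w, hw, l, hl, rfl⟩
    exact hB ⟨w, hw, hv.sub_closure hC hπ' hl⟩
  · rintro ⟨⟨w, hw, hwφ⟩, v, hv, hvW⟩
    exact hvW ⟨w, hw, v - w, hv.sub_mem_closure hG hwφ, add_sub_cancel w v⟩
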